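/- arXiv:1205.1935 — 10 statements merged into one kernel-verified Lean document; each statement's English description precedes it below -/
import Mathlib

section
/- Let n ≥ 1, j : Fin n → ℕ, a : Fin n → ℝ with Σ_{i} a_i (j_i + 1) = 0, and let x : ℝ → ℝⁿ be a solution of the system ẋ_i(t) = a_i x_i(t) ∏_{k} x_k(t)^{j_k} on an interval I (i.e. for each i and each t ∈ I, x_i has derivative a_i x_i(t) ∏_k x_k(t)^{j_k} at t). Then the function I₁(t) = ∏_{k} x_k(t)^{j_k + 1} is constant on I. -/
/-- If each `f i` has logarithmic derivative `c i` at `t`, then `∏ i ∈ s, f i` has logarithmic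
derivative `∑ i ∈ s, c i` at `t`. No non-vanishing assumption is needed. -/
theorem HasDerivAt.finsetProd_of_eq_mul {𝕜 ι : Type*} [NontriviallyNormedField 𝕜]
    {s : Finset ι} {f : ι → 𝕜 → 𝕜} {c : ι → 𝕜} {t : 𝕜}
    (h : ∀ i ∈ s, HasDerivAt (f i) (c i * f i t) t) :
    HasDerivAt (fun u => ∏ i ∈ s, f i u) ((∑ i ∈ s, c i) * ∏ i ∈ s, f i t) t := by
  classical
  refine (HasDerivAt.fun_finsetProd h).congr_deriv ?_
  rw [Finset.sum_mul]
  refine Finset.sum_congr rfl fun i hi => ?_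
  rw [← Finset.mul_prod_erase s (fun k => f k t) hi, smul_eq_mul]
  ring

/-- A function with zero derivative at every point of a convex set is constant on it. -/
theorem Convex.is_const_of_hasDerivAt_zero {I : Set ℝ} (hI : Convex ℝ I) {f : ℝ → ℝ}
    (hf : ∀ t ∈ I, HasDerivAt f 0 t) {t₁ t₂ : ℝ} (h₁ : t₁ ∈ I) (h₂ : t₂ ∈ I) :
    f t₁ = f t₂ := by
  have h := hI.norm_image_sub_le_of_norm_hasDerivWithin_le (C := 0)
    (fun t ht => (hf t ht).hasDerivWithinAt) (by simp) h₂ h₁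
  rw [zero_mul] at h
  exact sub_eq_zero.1 (norm_le_zero_iff.1 h)

/-- If `Σᵢ aᵢ (jᵢ+1) = 0` and `x` solves the EDFVF
`ẋᵢ = aᵢ xᵢ ∏ₖ x_k^{j_k}` on an interval `I`, then `I₁(t) = ∏ₖ x_k(t)^{j_k+1}`
is constant on `I`. -/
theorem stmt1 (n : ℕ) (hn : 1 ≤ n) (j : Fin n → ℕ) (a : Fin n → ℝ)
    (hdiv : ∑ i, a i * ((j i : ℝ) + 1) = 0)
    (I : Set ℝ) (hI : Convex ℝ I) (x : ℝ → Fin n → ℝ)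
    (hx : ∀ i, ∀ t ∈ I, HasDerivAt (fun s => x s i)
      (a i * x t i * ∏ k, x t k ^ j k) t) :
    ∀ t₁ ∈ I, ∀ t₂ ∈ I,
      ∏ k, x t₁ k ^ (j k + 1) = ∏ k, x t₂ k ^ (j k + 1) := by
  intro t₁ h₁ t₂ h₂
  refine hI.is_const_of_hasDerivAt_zero (f := fun t => ∏ k, x t k ^ (j k + 1))
    (fun t ht => ?_) h₁ h₂
  have hpow : ∀ k ∈ Finset.univ, HasDerivAt (fun s => x s k ^ (j k + 1))
      ((a k * ((j k : ℝ) + 1) * ∏ l, x t l ^ j l) * x t k ^ (j k + 1)) t := by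
    intro k _
    refine ((hx k t ht).fun_pow (j k + 1)).congr_deriv ?_
    push_cast
    ring
  have hprod := HasDerivAt.finsetProd_of_eq_mul hpow
  rwa [← Finset.sum_mul, hdiv, zero_mul, zero_mul] at hprod
end

section
/- Let n ≥ 1, j : Fin n → ℝ, a : Fin n → ℝ, and let x : ℝ → ℝⁿ be a solution on an interval I of the system ẋ_i(t) = a_i x_i(t) ∏_{k} x_k(t)^{j_k} (real powers) such that x_k(t) > 0 for all k and all t ∈ I. Let b : Fin n → ℝ satisfy Σ_{i} a_i b_i = 0. Then the function t ↦ ∏_{k} x_k(t)^{b_k} (real powers) is constant on I. -/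
/-- If `x` is a positive solution of the EDFVF with real exponents
`ẋᵢ = aᵢ xᵢ ∏ₖ x_k^{j_k}` on an interval `I` and `Σᵢ aᵢ bᵢ = 0`, then
`t ↦ ∏ₖ x_k(t)^{b_k}` (real powers) is constant on `I`. -/
theorem stmt2 (n : ℕ) (hn : 1 ≤ n) (j : Fin n → ℝ) (a : Fin n → ℝ)
    (I : Set ℝ) (hI : Convex ℝ I) (x : ℝ → Fin n → ℝ)
    (hpos : ∀ k, ∀ t ∈ I, 0 < x t k)
    (hx : ∀ i, ∀ t ∈ I, HasDerivAt (fun s => x s i)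
      (a i * x t i * ∏ k, x t k ^ j k) t)
    (b : Fin n → ℝ) (hb : ∑ i, a i * b i = 0) :
    ∀ t₁ ∈ I, ∀ t₂ ∈ I,
      ∏ k, x t₁ k ^ b k = ∏ k, x t₂ k ^ b k := by
  have prod_eq : ∀ t ∈ I, ∏ k, x t k ^ b k = Real.exp (∑ k, Real.log (x t k) * b k) := by
    intro t ht
    rw [Real.exp_sum]
    exact Finset.prod_congr rfl fun k _ => Real.rpow_def_of_pos (hpos k t ht) _
  have hasDeriv : ∀ t ∈ I,
      HasDerivWithinAt (fun s => ∑ k, Real.log (x s k) * b k) 0 I t := by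
    intro t ht
    have h := HasDerivAt.fun_sum (u := Finset.univ) fun k _ =>
      ((hx k t ht).log (hpos k t ht).ne').mul_const (b k)
    have h_zero : ∑ k, a k * x t k * (∏ i, x t i ^ j i) / x t k * b k = 0 := by
      calc ∑ k, a k * x t k * (∏ i, x t i ^ j i) / x t k * b k
          = ∑ k, (∏ i, x t i ^ j i) * (a k * b k) := by
            refine Finset.sum_congr rfl fun k _ => ?_
            have := (hpos k t ht).ne'
            field_simp
        _ = 0 := by rw [← Finset.mul_sum, hb, mul_zero]
    rw [h_zero] at h
    exact h.hasDerivWithinAt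
  intro t₁ h₁ t₂ h₂
  have h := hI.norm_image_sub_le_of_norm_hasDerivWithin_le (C := 0) hasDeriv
    (fun _ _ => norm_zero.le) h₂ h₁
  rw [zero_mul, norm_le_zero_iff, sub_eq_zero] at h
  rw [prod_eq t₁ h₁, prod_eq t₂ h₂, h]
end

section
/- Let n ≥ 1, j : Fin n → ℕ, a : Fin n → ℝ, and let x : ℝ → ℝⁿ be a solution on an interval I of the system ẋ_i(t) = a_i x_i(t) ∏_{k} x_k(t)^{j_k}. Set c_j = Σ_{i} a_i j_i. Then the function u(t) = ∏_{k} x_k(t)^{j_k} satisfies u′(t) = c_j · u(t)² for every t ∈ I. -/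
/-- If `x` solves the EDFVF `ẋᵢ = aᵢ xᵢ ∏ₖ x_k^{j_k}` on an interval `I`
and `c_j = Σᵢ aᵢ jᵢ`, then `u(t) = ∏ₖ x_k(t)^{j_k}` satisfies `u' = c_j u²` on `I`. -/
theorem stmt4 (n : ℕ) (hn : 1 ≤ n) (j : Fin n → ℕ) (a : Fin n → ℝ)
    (I : Set ℝ) (hI : Convex ℝ I) (x : ℝ → Fin n → ℝ)
    (hx : ∀ i, ∀ t ∈ I, HasDerivAt (fun s => x s i)
      (a i * x t i * ∏ k, x t k ^ j k) t)
    (c : ℝ) (hc : c = ∑ i, a i * (j i : ℝ)) :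
    ∀ t ∈ I, HasDerivAt (fun s => ∏ k, x s k ^ j k)
      (c * (∏ k, x t k ^ j k) ^ 2) t := by
  intro t ht
  refine (HasDerivAt.fun_finsetProd (u := Finset.univ)
    fun i _ => (hx i t ht).fun_pow (j i)).congr_deriv ?_
  rw [hc, Finset.sum_mul]
  refine Finset.sum_congr rfl fun i hi => ?_
  have pow_deriv : (j i : ℝ) * x t i ^ (j i - 1) * x t i = j i * x t i ^ j i := by
    rcases Nat.eq_zero_or_pos (j i) with h | h
    · simp [h]
    · rw [mul_assoc, pow_sub_one_mul h.ne']
  have prod_erase := Finset.prod_erase_mul Finset.univ (fun k => x t k ^ j k) hi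
  set u := ∏ k, x t k ^ j k
  rw [smul_eq_mul]
  linear_combination
    (∏ k ∈ Finset.univ.erase i, x t k ^ j k) * a i * u * pow_deriv + a i * j i * u * prod_erase
end

section
/- Let n ≥ 1, j : Fin n → ℕ, a : Fin n → ℝ, and set c_j = Σ_{i} a_i j_i and assume c_j ≠ 0. Fix t₀ ∈ ℝ and x⁰ ∈ ℝⁿ, and let X₀ = ∏_{k} (x⁰_k)^{j_k}. Define, for t in the interval J = {t : 1 − c_j X₀ (t − t₀) > 0}, x_i(t) = x⁰_i · (1 − c_j X₀ (t − t₀))^{−a_i/c_j} (real power of the positive base). Then x(t₀) = x⁰, for every t ∈ J one has ∏_{k} x_k(t)^{j_k} = X₀ / (1 − c_j X₀ (t − t₀)), and x solves the system on J, i.e. each x_i has derivative a_i x_i(t) ∏_{k} x_k(t)^{j_k} at every t ∈ J. -/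
/-- For `c_j = Σᵢ aᵢ jᵢ ≠ 0` the explicit formula
`xᵢ(t) = xᵢ⁰ (1 - c_j X₀ (t-t₀))^{-aᵢ/c_j}` satisfies the initial condition, the
monomial identity `∏ₖ x_k(t)^{j_k} = X₀ / (1 - c_j X₀ (t - t₀))`, and solves the EDFVF
on `J = {t : 1 - c_j X₀ (t - t₀) > 0}`. -/
theorem stmt5 (n : ℕ) (hn : 1 ≤ n) (j : Fin n → ℕ) (a : Fin n → ℝ)
    (c : ℝ) (hc : c = ∑ i, a i * (j i : ℝ)) (hc0 : c ≠ 0)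
    (t₀ : ℝ) (x0 : Fin n → ℝ) (X₀ : ℝ) (hX₀ : X₀ = ∏ k, x0 k ^ j k)
    (x : ℝ → Fin n → ℝ)
    (hx : ∀ t i, x t i = x0 i * (1 - c * X₀ * (t - t₀)) ^ (-(a i) / c)) :
    x t₀ = x0 ∧
    (∀ t, 0 < 1 - c * X₀ * (t - t₀) →
      ∏ k, x t k ^ j k = X₀ / (1 - c * X₀ * (t - t₀))) ∧
    (∀ t, 0 < 1 - c * X₀ * (t - t₀) → ∀ i,
      HasDerivAt (fun s => x s i) (a i * x t i * ∏ k, x t k ^ j k) t) := by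
  have monomial_eq : ∀ t, 0 < 1 - c * X₀ * (t - t₀) →
      ∏ k, x t k ^ j k = X₀ / (1 - c * X₀ * (t - t₀)) := by
    intro t ht
    have hexp : ∑ k, -(a k) / c * (j k : ℝ) = -1 := by
      calc ∑ k, -(a k) / c * (j k : ℝ) = -(∑ k, a k * (j k : ℝ)) / c := by
            rw [← Finset.sum_neg_distrib, Finset.sum_div]
            exact Finset.sum_congr rfl fun k _ => by ring
        _ = -1 := by rw [← hc, neg_div, div_self hc0]
    simp only [hx, mul_pow, Finset.prod_mul_distrib, ← Real.rpow_mul_natCast ht.le]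
    rw [← Real.rpow_sum_of_pos ht, hexp, Real.rpow_neg_one, ← hX₀, div_eq_mul_inv]
  refine ⟨?_, monomial_eq, fun t ht i => ?_⟩
  · ext i
    simp [hx]
  · rw [monomial_eq t ht]
    simp only [hx]
    have hbase : HasDerivAt (fun s => 1 - c * X₀ * (s - t₀)) (-(c * X₀)) t := by
      simpa using (((hasDerivAt_id t).sub_const t₀).const_mul (c * X₀)).const_sub 1
    refine ((hbase.rpow_const (p := -(a i) / c) (Or.inl ht.ne')).const_mul (x0 i)).congr_deriv ?_
    rw [Real.rpow_sub_one ht.ne']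
    have hne := ht.ne'
    generalize (1 - c * X₀ * (t - t₀)) ^ (-(a i) / c) = y
    generalize 1 - c * X₀ * (t - t₀) = u at hne ⊢
    field_simp
end

section
/- Let n ≥ 1, j : Fin n → ℕ, a : Fin n → ℝ, and assume c_j = Σ_{i} a_i j_i = 0. Fix t₀ ∈ ℝ and x⁰ ∈ ℝⁿ, and let X₀ = ∏_{k} (x⁰_k)^{j_k}. Define x_i(t) = x⁰_i · exp(a_i X₀ (t − t₀)) for all t ∈ ℝ. Then x(t₀) = x⁰, the monomial ∏_{k} x_k(t)^{j_k} equals X₀ for all t, and x solves the system ẋ_i(t) = a_i x_i(t) ∏_{k} x_k(t)^{j_k} on all of ℝ. -/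
/-- For `c_j = Σᵢ aᵢ jᵢ = 0` the explicit formula
`xᵢ(t) = xᵢ⁰ exp(aᵢ X₀ (t - t₀))` satisfies the initial condition, keeps the monomial
`∏ₖ x_k(t)^{j_k}` constantly equal to `X₀`, and solves the EDFVF on all of `ℝ`. -/
theorem stmt6 (n : ℕ) (hn : 1 ≤ n) (j : Fin n → ℕ) (a : Fin n → ℝ)
    (hc : ∑ i, a i * (j i : ℝ) = 0)
    (t₀ : ℝ) (x0 : Fin n → ℝ) (X₀ : ℝ) (hX₀ : X₀ = ∏ k, x0 k ^ j k)
    (x : ℝ → Fin n → ℝ)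
    (hx : ∀ t i, x t i = x0 i * Real.exp (a i * X₀ * (t - t₀))) :
    x t₀ = x0 ∧
    (∀ t, ∏ k, x t k ^ j k = X₀) ∧
    (∀ t i, HasDerivAt (fun s => x s i) (a i * x t i * ∏ k, x t k ^ j k) t) := by
  have hmon : ∀ t, ∏ k, x t k ^ j k = X₀ := by
    intro t
    have hexp : ∑ k, (j k : ℝ) * (a k * X₀ * (t - t₀)) = 0 := by
      calc ∑ k, (j k : ℝ) * (a k * X₀ * (t - t₀))
          = (∑ k, a k * (j k : ℝ)) * (X₀ * (t - t₀)) := by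
            rw [Finset.sum_mul]
            exact Finset.sum_congr rfl fun k _ => by ring
        _ = 0 := by rw [hc, zero_mul]
    simp only [hx, mul_pow, Finset.prod_mul_distrib, ← Real.exp_nat_mul, ← Real.exp_sum]
    rw [hexp, Real.exp_zero, mul_one, hX₀]
  refine ⟨?_, hmon, fun t i => ?_⟩
  · ext i
    simp [hx]
  · rw [hmon t]
    simp only [hx]
    have h := ((((hasDerivAt_id' t).sub_const t₀).const_mul (a i * X₀)).exp).const_mul (x0 i)
    refine h.congr_deriv ?_
    ring
end

section
/- Let n ≥ 1 and let f : Fin n → MvPolynomial (Fin n) ℝ be diagonal, meaning that for each i every multi-index k in the support of f_i satisfies k_i ≥ 1, and divergence-free, meaning Σ_{i} pderiv i (f i) = 0. For each multi-index j : Fin n → ℕ define the polynomial family (F_j)_i = coeff_{j+e_i}(f_i) · X_i · X^j (a scalar multiple of the monomial X^{j+e_i}). Then: (1) each family F_j is divergence-free, i.e. Σ_{i} pderiv i ((F_j)_i) = 0; and (2) f_i = Σ_{j ∈ S} (F_j)_i for each i, where S is the (finite) set of multi-indices j such that j + e_i lies in the support of f_i for some i. Moreover this decomposition is unique: the diagonal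 summand of f contributing to the divergence coefficient at j is exactly F_j. -/
open MvPolynomial in
theorem MvPolynomial.pderiv_monomial_add_single {σ R : Type*} [CommSemiring R]
    (i : σ) (j : σ →₀ ℕ) (c : R) :
    pderiv i (monomial (j + Finsupp.single i 1) c) = monomial j (c * (j i + 1)) := by
  rw [pderiv_monomial]
  simp

open MvPolynomial in
theorem MvPolynomial.coeff_sum_monomial_add_right {σ R : Type*} [CommSemiring R]
    [DecidableEq σ] (S : Finset (σ →₀ ℕ)) (c : (σ →₀ ℕ) → R) (j e : σ →₀ ℕ) :
    coeff (j + e) (∑ l ∈ S, monomial (l + e) (c l)) = if j ∈ S then c j else 0 := by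
  simp [coeff_sum, coeff_monomial]

/-- A diagonal divergence-free polynomial vector field splits uniquely
into the elementary divergence-free vector fields `(F_j)_i = coeff_{j+eᵢ}(fᵢ)·X_i·X^j`:
each `F_j` is divergence-free, `f` is the sum of the `F_j` over the relevant finite set
of multi-indices, and the decomposition is unique. -/
theorem stmt9 (n : ℕ) (hn : 1 ≤ n) (f : Fin n → MvPolynomial (Fin n) ℝ)
    (hdiag : ∀ i, ∀ k ∈ (f i).support, 1 ≤ k i)
    (hdivfree : ∑ i, MvPolynomial.pderiv i (f i) = 0)
    (F : (Fin n →₀ ℕ) → Fin n → MvPolynomial (Fin n) ℝ)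
    (hF : ∀ j i, F j i = MvPolynomial.monomial (j + Finsupp.single i 1)
        (MvPolynomial.coeff (j + Finsupp.single i 1) (f i)))
    (S : Finset (Fin n →₀ ℕ))
    (hS : ∀ j, j ∈ S ↔ ∃ i, j + Finsupp.single i 1 ∈ (f i).support) :
    (∀ j, ∑ i, MvPolynomial.pderiv i (F j i) = 0) ∧
    (∀ i, f i = ∑ j ∈ S, F j i) ∧
    (∀ G : (Fin n →₀ ℕ) → Fin n → MvPolynomial (Fin n) ℝ,
      (∀ j i, ∃ c : ℝ, G j i = MvPolynomial.monomial (j + Finsupp.single i 1) c) →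
      (∀ i, f i = ∑ j ∈ S, G j i) →
      ∀ j ∈ S, G j = F j) := by
  classical
  refine ⟨fun j => ?_, fun i => ?_, fun G hG hf j hj => funext fun i => ?_⟩
  · have h := congrArg (MvPolynomial.coeff j) hdivfree
    simp only [MvPolynomial.coeff_sum, MvPolynomial.coeff_pderiv,
      MvPolynomial.coeff_zero] at h
    simp only [hF, MvPolynomial.pderiv_monomial_add_single]
    rw [← map_sum, h, map_zero]
  · ext k
    simp only [hF]
    by_cases hk : k i = 0
    · have hzero : MvPolynomial.coeff k (f i) = 0 := by
        by_contra h
        have := hdiag i k (MvPolynomial.mem_support_iff.2 h)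
        omega
      rw [hzero, MvPolynomial.coeff_sum, Finset.sum_eq_zero]
      intro j _
      rw [MvPolynomial.coeff_monomial, if_neg]
      rintro rfl
      simp at hk
    · obtain ⟨j, rfl⟩ : ∃ j, k = j + Finsupp.single i 1 :=
        ⟨k - Finsupp.single i 1,
          (tsub_add_cancel_of_le (Finsupp.single_le_iff.2 (Nat.one_le_iff_ne_zero.2 hk))).symm⟩
      rw [MvPolynomial.coeff_sum_monomial_add_right S
        fun j => MvPolynomial.coeff (j + Finsupp.single i 1) (f i)]
      split_ifs with hj
      · rfl
      · by_contra h
        exact hj ((hS j).2 ⟨i, MvPolynomial.mem_support_iff.2 h⟩)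
  · choose c hc using hG
    have h := congrArg (MvPolynomial.coeff (j + Finsupp.single i 1)) (hf i)
    simp only [hc] at h
    rw [MvPolynomial.coeff_sum_monomial_add_right S fun j => c j i, if_pos hj] at h
    rw [hc, hF, h]
end

section
/- Let n ≥ 1, j : Fin n → ℕ, a : Fin n → ℝ with Σ_{i} a_i (j_i + 1) = 0. Let x : ℝ → ℝⁿ be a solution on an interval I of the system ẋ_i(t) = a_i x_i(t) ∏_{k} x_k(t)^{j_k}, with x_k(t) ≠ 0 for all k and all t ∈ I, and fix t₀ ∈ I. Then for every t ∈ I and every i, the derivative of x_i at t equals a_i · (∏_{k} x_k(t₀)^{j_k + 1}) · ∏_{k ≠ i} x_k(t)^{−1}; that is, x also solves the off-diagonal divergence-free system ẋ_i = a_i I₁(t₀) x^{−1+e_i} whose right-hand side for the i-th equation does not depend on x_i. -/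
/-- Along a solution of a divergence-free EDFVF, the quantity `∏ₖ x_k^{j_k+1}` has
derivative zero. -/
theorem hasDerivAt_prod_pow_succ_zero {ι : Type*} [Fintype ι] [DecidableEq ι] (j : ι → ℕ)
    (a : ι → ℝ) (hdiv : ∑ i, a i * ((j i : ℝ) + 1) = 0) (x : ℝ → ι → ℝ) (t : ℝ)
    (hx : ∀ i, HasDerivAt (fun s => x s i) (a i * x t i * ∏ k, x t k ^ j k) t) :
    HasDerivAt (fun s => ∏ k, x s k ^ (j k + 1)) 0 t := by
  have h := HasDerivAt.fun_finsetProd (u := Finset.univ)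
    (fun i _ => (hx i).fun_pow (j i + 1))
  refine h.congr_deriv ?_
  have hterm : ∀ i ∈ Finset.univ,
      (∏ k ∈ Finset.univ.erase i, x t k ^ (j k + 1)) •
        (((j i + 1 : ℕ) : ℝ) * x t i ^ (j i + 1 - 1) * (a i * x t i * ∏ k, x t k ^ j k)) =
      (a i * ((j i : ℝ) + 1)) * ((∏ k, x t k ^ (j k + 1)) * ∏ k, x t k ^ j k) := by
    intro i hi
    rw [← Finset.mul_prod_erase Finset.univ (fun k => x t k ^ (j k + 1)) hi]
    simp only [smul_eq_mul, Nat.add_sub_cancel]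
    push_cast
    ring
  rw [Finset.sum_congr rfl hterm, ← Finset.sum_mul, hdiv, zero_mul]


/-- A nowhere-vanishing solution of the divergence-free EDFVF
`ẋᵢ = aᵢ xᵢ ∏ₖ x_k^{j_k}` also solves the off-diagonal system
`ẋᵢ = aᵢ I₁(t₀) ∏_{k ≠ i} x_k⁻¹`, where `I₁(t₀) = ∏ₖ x_k(t₀)^{j_k+1}`. -/
theorem stmt10 (n : ℕ) (hn : 1 ≤ n) (j : Fin n → ℕ) (a : Fin n → ℝ)
    (hdiv : ∑ i, a i * ((j i : ℝ) + 1) = 0)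
    (I : Set ℝ) (hI : Convex ℝ I) (x : ℝ → Fin n → ℝ)
    (hne : ∀ k, ∀ t ∈ I, x t k ≠ 0)
    (hx : ∀ i, ∀ t ∈ I, HasDerivAt (fun s => x s i)
      (a i * x t i * ∏ k, x t k ^ j k) t)
    (t₀ : ℝ) (ht₀ : t₀ ∈ I) :
    ∀ t ∈ I, ∀ i, HasDerivAt (fun s => x s i)
      (a i * (∏ k, x t₀ k ^ (j k + 1)) * ∏ k ∈ Finset.univ.erase i, (x t k)⁻¹) t := by
  intro t ht i
  have hconst : ∏ k, x t k ^ (j k + 1) = ∏ k, x t₀ k ^ (j k + 1) := by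
    have h := hI.norm_image_sub_le_of_norm_hasDerivWithin_le (C := 0)
      (fun s hs => (hasDerivAt_prod_pow_succ_zero j a hdiv x s
        (fun i => hx i s hs)).hasDerivWithinAt)
      (fun s _ => norm_zero.le) ht₀ ht
    rw [zero_mul] at h
    exact sub_eq_zero.mp (norm_le_zero_iff.mp h)
  refine (hx i t ht).congr_deriv ?_
  have hprod : ∏ k ∈ Finset.univ.erase i, x t k ≠ 0 :=
    Finset.prod_ne_zero_iff.mpr fun k _ => hne k t ht
  rw [← hconst]
  simp only [pow_succ, Finset.prod_mul_distrib, Finset.prod_inv_distrib]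
  rw [← Finset.mul_prod_erase Finset.univ (fun k => x t k) (Finset.mem_univ i)]
  field_simp
end

section
/- Let n ≥ 1, j : Fin n → ℝ, a : Fin n → ℝ, and let x : ℝ → ℝⁿ be a solution on an interval I of the system ẋ_i(t) = a_i x_i(t) ∏_{k} x_k(t)^{j_k} (real powers) with x_k(t) > 0 for all k and all t ∈ I. Set c_j = Σ_{i} a_i j_i. Then the function u(t) = ∏_{k} x_k(t)^{j_k} satisfies u′(t) = c_j · u(t)² for every t ∈ I. -/
/-- If `x` is a positive solution of the EDFVF with real exponents
`ẋᵢ = aᵢ xᵢ ∏ₖ x_k^{j_k}` (real powers) on an interval `I` and `c_j = Σᵢ aᵢ jᵢ`, then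
`u(t) = ∏ₖ x_k(t)^{j_k}` satisfies `u' = c_j u²` on `I`. -/
theorem stmt12 (n : ℕ) (hn : 1 ≤ n) (j : Fin n → ℝ) (a : Fin n → ℝ)
    (I : Set ℝ) (hI : Convex ℝ I) (x : ℝ → Fin n → ℝ)
    (hpos : ∀ k, ∀ t ∈ I, 0 < x t k)
    (hx : ∀ i, ∀ t ∈ I, HasDerivAt (fun s => x s i)
      (a i * x t i * ∏ k, x t k ^ j k) t)
    (c : ℝ) (hc : c = ∑ i, a i * j i) :
    ∀ t ∈ I, HasDerivAt (fun s => ∏ k, x s k ^ j k)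
      (c * (∏ k, x t k ^ j k) ^ 2) t := by
  intro t ht
  have hfactor : ∀ i, HasDerivAt (fun s => x s i ^ j i)
      (a i * j i * (∏ k, x t k ^ j k) * x t i ^ j i) t := by
    intro i
    have hne : x t i ≠ 0 := (hpos i t ht).ne'
    convert (hx i t ht).rpow_const (p := j i) (Or.inl hne) using 1
    rw [Real.rpow_sub_one hne]
    field_simp
  refine (HasDerivAt.fun_finsetProd (u := Finset.univ) fun i _ => hfactor i).congr_deriv ?_
  symm
  rw [hc, Finset.sum_mul]
  refine Finset.sum_congr rfl fun i hi => ?_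
  rw [smul_eq_mul, sq]
  nth_rewrite 1 [← Finset.prod_erase_mul _ _ hi]
  ring
end

section
/- Let n ≥ 1, j : Fin n → ℝ, a : Fin n → ℝ, set c_j = Σ_{i} a_i j_i and assume c_j ≠ 0. Fix t₀ ∈ ℝ and x⁰ ∈ ℝⁿ with x⁰_k > 0 for all k, and let X₀ = ∏_{k} (x⁰_k)^{j_k} (real powers). Define, for t in J = {t : 1 − c_j X₀ (t − t₀) > 0}, x_i(t) = x⁰_i · (1 − c_j X₀ (t − t₀))^{−a_i/c_j}. Then x(t₀) = x⁰, each x_i(t) > 0 on J, ∏_{k} x_k(t)^{j_k} = X₀ / (1 − c_j X₀ (t − t₀)) for every t ∈ J, and x solves the system ẋ_i(t) = a_i x_i(t) ∏_{k} x_k(t)^{j_k} on J. -/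
/-- A monomial with real exponents, evaluated along a power curve `k ↦ u k * β ^ p k`. -/
theorem prod_mul_rpow_rpow {ι : Type*} [Fintype ι] (u p j : ι → ℝ) (hu : ∀ k, 0 < u k)
    {β : ℝ} (hβ : 0 < β) :
    ∏ k, (u k * β ^ p k) ^ j k = (∏ k, u k ^ j k) * β ^ ∑ k, p k * j k := by
  rw [Real.rpow_sum_of_pos hβ, ← Finset.prod_mul_distrib]
  refine Finset.prod_congr rfl fun k _ => ?_
  rw [Real.mul_rpow (hu k).le (Real.rpow_nonneg hβ.le _), ← Real.rpow_mul hβ.le]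


/-- For real exponents `j`, `c_j = Σᵢ aᵢ jᵢ ≠ 0`, and positive initial
data `x⁰`, the formula `xᵢ(t) = xᵢ⁰ (1 - c_j X₀ (t-t₀))^{-aᵢ/c_j}` satisfies the
initial condition, stays positive, has `∏ₖ x_k(t)^{j_k} = X₀ / (1 - c_j X₀ (t-t₀))`,
and solves the EDFVF on `J = {t : 1 - c_j X₀ (t - t₀) > 0}`. -/
theorem stmt13 (n : ℕ) (hn : 1 ≤ n) (j : Fin n → ℝ) (a : Fin n → ℝ)
    (c : ℝ) (hc : c = ∑ i, a i * j i) (hc0 : c ≠ 0)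
    (t₀ : ℝ) (x0 : Fin n → ℝ) (hx0 : ∀ k, 0 < x0 k)
    (X₀ : ℝ) (hX₀ : X₀ = ∏ k, x0 k ^ j k)
    (x : ℝ → Fin n → ℝ)
    (hx : ∀ t i, x t i = x0 i * (1 - c * X₀ * (t - t₀)) ^ (-(a i) / c)) :
    x t₀ = x0 ∧
    (∀ t, 0 < 1 - c * X₀ * (t - t₀) → ∀ i, 0 < x t i) ∧
    (∀ t, 0 < 1 - c * X₀ * (t - t₀) →
      ∏ k, x t k ^ j k = X₀ / (1 - c * X₀ * (t - t₀))) ∧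
    (∀ t, 0 < 1 - c * X₀ * (t - t₀) → ∀ i,
      HasDerivAt (fun s => x s i) (a i * x t i * ∏ k, x t k ^ j k) t) := by
  have hprod : ∀ t, 0 < 1 - c * X₀ * (t - t₀) →
      ∏ k, x t k ^ j k = X₀ / (1 - c * X₀ * (t - t₀)) := by
    intro t ht
    have hsum : ∑ k, -(a k) / c * j k = -1 := by
      have : ∀ k, -(a k) / c * j k = -(1 / c) * (a k * j k) := fun k => by ring
      simp_rw [this]
      rw [← Finset.mul_sum, ← hc]
      field_simp
    simp_rw [hx]
    rw [prod_mul_rpow_rpow x0 (fun k => -(a k) / c) j hx0 ht, hsum, ← hX₀,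
      Real.rpow_neg_one, div_eq_mul_inv]
  refine ⟨?_, ?_, hprod, ?_⟩
  · ext i
    simp [hx]
  · intro t ht i
    rw [hx]
    exact mul_pos (hx0 i) (Real.rpow_pos_of_pos ht _)
  · intro t ht i
    rw [hprod t ht]
    simp_rw [hx]
    have hlin : HasDerivAt (fun s => 1 - c * X₀ * (s - t₀)) (-(c * X₀)) t := by
      simpa using (((hasDerivAt_id t).sub_const t₀).const_mul (c * X₀)).const_sub 1
    refine ((hlin.rpow_const (p := -(a i) / c) (Or.inl ht.ne')).const_mul (x0 i)).congr_deriv ?_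
    rw [Real.rpow_sub_one ht.ne']
    field_simp
end

section
/- Let n ≥ 1, j : Fin n → ℝ, a : Fin n → ℝ, and assume c_j = Σ_{i} a_i j_i = 0. Fix t₀ ∈ ℝ and x⁰ ∈ ℝⁿ with x⁰_k > 0 for all k, and let X₀ = ∏_{k} (x⁰_k)^{j_k} (real powers). Define x_i(t) = x⁰_i · exp(a_i X₀ (t − t₀)) for all t ∈ ℝ. Then x(t₀) = x⁰, each x_i(t) > 0, the function ∏_{k} x_k(t)^{j_k} is constantly equal to X₀, and x solves the system ẋ_i(t) = a_i x_i(t) ∏_{k} x_k(t)^{j_k} on all of ℝ. -/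
/-- For real exponents `j` with `c_j = Σᵢ aᵢ jᵢ = 0` and positive
initial data, the formula `xᵢ(t) = xᵢ⁰ exp(aᵢ X₀ (t-t₀))` satisfies the initial
condition, stays positive, keeps `∏ₖ x_k(t)^{j_k}` constantly equal to `X₀`, and
solves the EDFVF on all of `ℝ`. -/
theorem stmt14 (n : ℕ) (hn : 1 ≤ n) (j : Fin n → ℝ) (a : Fin n → ℝ)
    (hc : ∑ i, a i * j i = 0)
    (t₀ : ℝ) (x0 : Fin n → ℝ) (hx0 : ∀ k, 0 < x0 k)
    (X₀ : ℝ) (hX₀ : X₀ = ∏ k, x0 k ^ j k)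
    (x : ℝ → Fin n → ℝ)
    (hx : ∀ t i, x t i = x0 i * Real.exp (a i * X₀ * (t - t₀))) :
    x t₀ = x0 ∧
    (∀ t i, 0 < x t i) ∧
    (∀ t, ∏ k, x t k ^ j k = X₀) ∧
    (∀ t i, HasDerivAt (fun s => x s i) (a i * x t i * ∏ k, x t k ^ j k) t) := by
  have hprod : ∀ t, ∏ k, x t k ^ j k = X₀ := fun t ↦ by
    have hfactor : ∀ k, x t k ^ j k =
        x0 k ^ j k * Real.exp (a k * j k * (X₀ * (t - t₀))) := fun k ↦ by
      rw [hx, Real.mul_rpow (hx0 k).le (Real.exp_pos _).le, ← Real.exp_mul]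
      ring_nf
    simp_rw [hfactor]
    rw [Finset.prod_mul_distrib, ← Real.exp_sum, ← Finset.sum_mul, hc, zero_mul,
      Real.exp_zero, mul_one, hX₀]
  refine ⟨?_, fun t i ↦ ?_, hprod, fun t i ↦ ?_⟩
  · ext i
    simp [hx]
  · rw [hx]
    exact mul_pos (hx0 i) (Real.exp_pos _)
  · rw [hprod]
    simp only [hx]
    have hlin : HasDerivAt (fun s ↦ a i * X₀ * (s - t₀)) (a i * X₀ * 1) t :=
      ((hasDerivAt_id t).sub_const t₀).const_mul (a i * X₀)
    exact (hlin.exp.const_mul (x0 i)).congr_deriv (by ring)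
end
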